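/- arXiv:1505.04075 — 2 statements merged into one kernel-verified Lean document; each statement's English description precedes it below -/
import Mathlib

section
/- An element w of the symmetric group S_{n+1} is fully commutative (no reduced word for w contains a factor of the form [i, i±1, i]) if and only if w can be written in the form T_{i_1}^{m_1} T_{i_2}^{m_2} ⋯ T_{i_ℓ}^{m_ℓ} with i_j ≤ m_j for all j, i_1 < i_2 < ⋯ < i_ℓ, and m_1 < m_2 < ⋯ < m_ℓ; moreover this expression is unique. -/
/-- The `i`-th simple transposition `sₙ i = (i-1, i)` in the symmetric group `S_{n+1}`
on `{0, …, n}`, for `1 ≤ i ≤ n` (and the identity otherwise).  In the usual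
`1`-based labelling this is the simple transposition `s_i` swapping `i` and `i+1`. -/
def sgen (n : ℕ) (i : ℕ) : Equiv.Perm (Fin (n + 1)) :=
  if h : 0 < i ∧ i ≤ n then Equiv.swap ⟨i - 1, by omega⟩ ⟨i, by omega⟩ else 1

/-- The segment `T_i^j = s_j s_{j-1} ⋯ s_{i+1} s_i` (the identity when `i > j`). -/
def seg (n i j : ℕ) : Equiv.Perm (Fin (n + 1)) :=
  ((List.range' i (j + 1 - i)).reverse.map (sgen n)).prod

/-- The decreasing word `[j, j-1, …, i+1, i]` spelling the segment `T_i^j`. -/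
def segWord (i j : ℕ) : List ℕ :=
  (List.range' i (j + 1 - i)).reverse

/-- The product of the word `l` of simple transpositions in `S_{n+1}`. -/
def wprod (n : ℕ) (l : List ℕ) : Equiv.Perm (Fin (n + 1)) :=
  (l.map (sgen n)).prod

/-- `l` is a reduced word for `w`: a word in the letters `1, …, n` of minimal length
whose product of simple transpositions is `w`. -/
def IsReducedWord (n : ℕ) (w : Equiv.Perm (Fin (n + 1))) (l : List ℕ) : Prop :=
  (∀ i ∈ l, 1 ≤ i ∧ i ≤ n) ∧ wprod n l = w ∧
    ∀ l' : List ℕ, (∀ i ∈ l', 1 ≤ i ∧ i ≤ n) → wprod n l' = w → l.length ≤ l'.length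

/-- `w` is fully commutative: no reduced word for `w` contains a factor `[i, i', i]`
with `|i - i'| = 1`. -/
def FullyCommutative (n : ℕ) (w : Equiv.Perm (Fin (n + 1))) : Prop :=
  ∀ l : List ℕ, IsReducedWord n w l →
    ∀ i i' : ℕ, (i + 1 = i' ∨ i' + 1 = i) → ¬ ([i, i', i] <:+: l)

theorem sgen_apply_val (n k : ℕ) (v : Fin (n + 1)) :
    (sgen n k v : ℕ) =
      if 0 < k ∧ k ≤ n then (if (v : ℕ) + 1 = k then k else if (v : ℕ) = k then k - 1 else v)
      else v := by
  unfold sgen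
  split_ifs with h h1 h2
  · rw [Equiv.swap_apply_def, if_pos (Fin.ext (by simp only; omega))]
  · rw [Equiv.swap_apply_def, if_neg (by rw [Fin.ext_iff]; simp only; omega),
      if_pos (Fin.ext (by simpa using h2))]
  · rw [Equiv.swap_apply_def, if_neg (by rw [Fin.ext_iff]; simp only; omega),
      if_neg (by rw [Fin.ext_iff]; exact h2)]
  · rfl

theorem sgen_eq_swap {n k : ℕ} {p q : Fin (n + 1)} (hp : (p : ℕ) + 1 = k) (hq : (q : ℕ) = k) :
    sgen n k = Equiv.swap p q := by
  have := q.2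
  rw [sgen, dif_pos (by omega)]
  congr 1 <;> exact Fin.ext (by simp only; omega)

theorem sgen_commute {n i j : ℕ} (h : i + 2 ≤ j ∨ j + 2 ≤ i) :
    Commute (sgen n i) (sgen n j) := by
  refine Equiv.ext fun v => Fin.ext ?_
  simp only [Equiv.Perm.mul_apply, sgen_apply_val]
  grind

theorem wprod_nil (n : ℕ) : wprod n [] = 1 := rfl

theorem wprod_cons (n k : ℕ) (l : List ℕ) : wprod n (k :: l) = sgen n k * wprod n l := rfl

theorem wprod_append (n : ℕ) (l l' : List ℕ) :
    wprod n (l ++ l') = wprod n l * wprod n l' := by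
  simp [wprod]

/-! ### Reduced words -/

theorem IsReducedWord.of_append {n : ℕ} {w : Equiv.Perm (Fin (n + 1))} {a b c : List ℕ}
    (h : IsReducedWord n w (a ++ b ++ c)) : IsReducedWord n (wprod n b) b := by
  obtain ⟨h1, h2, h3⟩ := h
  refine ⟨fun i hi => h1 i (by simp [hi]), rfl, fun l' hl' he => ?_⟩
  have := h3 (a ++ l' ++ c) (fun i hi => ?_) (by rw [← h2]; simp [wprod_append, he])
  · simp only [List.length_append] at this
    omega
  · simp only [List.mem_append] at hi
    rcases hi with (hi | hi) | hi
    · exact h1 i (by simp [hi])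
    · exact hl' i hi
    · exact h1 i (by simp [hi])

theorem IsReducedWord.of_length_le {n : ℕ} {w : Equiv.Perm (Fin (n + 1))} {l l' : List ℕ}
    (h : IsReducedWord n w l) (hv : ∀ i ∈ l', 1 ≤ i ∧ i ≤ n) (he : wprod n l' = w)
    (hl : l'.length ≤ l.length) : IsReducedWord n w l' :=
  ⟨hv, he, fun m hm hme => hl.trans (h.2.2 m hm hme)⟩

theorem exists_isReducedWord (n : ℕ) (w : Equiv.Perm (Fin (n + 1))) :
    ∃ l, IsReducedWord n w l := by
  have hne : ∃ l : List ℕ, (∀ i ∈ l, 1 ≤ i ∧ i ≤ n) ∧ wprod n l = w := by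
    have hw : w ∈ Submonoid.closure
        (Set.range fun i : Fin n => Equiv.swap i.castSucc i.succ) := by
      rw [Equiv.Perm.mclosure_swap_castSucc_succ]; trivial
    induction hw using Submonoid.closure_induction with
    | mem x hx =>
      obtain ⟨i, rfl⟩ := hx
      refine ⟨[i + 1], by simp, ?_⟩
      simp only [wprod, List.map_cons, List.map_nil, List.prod_cons, List.prod_nil, mul_one]
      exact sgen_eq_swap (by simp) (by simp)
    | one => exact ⟨[], by simp, rfl⟩
    | mul x y _ _ hx hy =>
      obtain ⟨a, ha, rfl⟩ := hx
      obtain ⟨b, hb, rfl⟩ := hy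
      exact ⟨a ++ b, fun i hi => (List.mem_append.1 hi).elim (ha i) (hb i), wprod_append ..⟩
  let S : Set (List ℕ) := {l | (∀ i ∈ l, 1 ≤ i ∧ i ≤ n) ∧ wprod n l = w}
  obtain ⟨l, hl, hmin⟩ := WellFounded.has_min (measure (List.length (α := ℕ))).wf S hne
  exact ⟨l, hl.1, hl.2, fun l' h1 h2 => not_lt.1 (hmin l' ⟨h1, h2⟩)⟩

/-- If a word inverts the pair `x < y`, then one of its letters exchanges the two. -/
theorem exists_crossing {n : ℕ} {x y : Fin (n + 1)} (hxy : x < y) (l : List ℕ)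
    (h : wprod n l y < wprod n l x) :
    ∃ a k b, l = a ++ k :: b ∧ (wprod n b x : ℕ) + 1 = k ∧ (wprod n b y : ℕ) = k := by
  induction l with
  | nil => exact absurd hxy (not_lt.2 h.le)
  | cons k l ih =>
    by_cases hl : wprod n l y < wprod n l x
    · obtain ⟨a, j, b, rfl, h1, h2⟩ := ih hl
      exact ⟨k :: a, j, b, rfl, h1, h2⟩
    · refine ⟨[], k, l, rfl, ?_⟩
      have hne : wprod n l x ≠ wprod n l y := fun he => hxy.ne ((wprod n l).injective he)
      rw [wprod_cons, Equiv.Perm.mul_apply, Equiv.Perm.mul_apply, Fin.lt_def, sgen_apply_val,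
        sgen_apply_val] at h
      rw [Fin.lt_def] at hl
      rw [ne_eq, Fin.ext_iff] at hne
      grind

/-- Pairs inverted by a suffix of a reduced word are inverted by the whole word. -/
theorem IsReducedWord.inverts_of_suffix {n : ℕ} {w : Equiv.Perm (Fin (n + 1))} {a c : List ℕ}
    (hr : IsReducedWord n w (a ++ c)) {x y : Fin (n + 1)} (hxy : x < y)
    (h : wprod n c y < wprod n c x) : w y < w x := by
  obtain ⟨hv, rfl, hmin⟩ := hr
  by_contra hlt
  have hlt' : wprod n a (wprod n c x) < wprod n a (wprod n c y) := by
    rw [wprod_append, Equiv.Perm.mul_apply, Equiv.Perm.mul_apply, not_lt] at hlt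
    exact lt_of_le_of_ne hlt fun he =>
      hxy.ne ((wprod n c).injective ((wprod n a).injective he))
  obtain ⟨c₁, j, b, rfl, hbx, hby⟩ := exists_crossing hxy c h
  obtain ⟨a₁, k, a₂, rfl, hay, hax⟩ := exists_crossing h a hlt'
  set u := wprod n (a₂ ++ c₁) with hu
  have hj : sgen n j = Equiv.swap (wprod n b x) (wprod n b y) := sgen_eq_swap hbx hby
  have hk : sgen n k = Equiv.swap (u (wprod n b x)) (u (wprod n b y)) := by
    refine sgen_eq_swap ?_ ?_
    · simpa [wprod_append, wprod_cons, hj, hu] using hay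
    · simpa [wprod_append, wprod_cons, hj, hu] using hax
  have hlen := hmin (a₁ ++ a₂ ++ c₁ ++ b) (fun i hi => hv i (by
    simp only [List.mem_append, List.mem_cons] at hi ⊢; tauto)) (by
      have key : sgen n k * u * sgen n j = u := by
        rw [hk, hj, Equiv.swap_apply_apply]
        simp [mul_assoc]
      have h1 : wprod n (a₁ ++ a₂ ++ c₁ ++ b) = wprod n a₁ * u * wprod n b := by
        simp [wprod_append, hu, mul_assoc]
      rw [h1, ← key]
      simp [wprod_append, wprod_cons, hu, mul_assoc])
  simp only [List.length_append, List.length_cons] at hlen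
  omega

/-- The first letter of a reduced word creates an inversion. -/
theorem IsReducedWord.lt_of_cons {n k : ℕ} {w : Equiv.Perm (Fin (n + 1))} {c : List ℕ}
    (hr : IsReducedWord n w (k :: c)) {x y : Fin (n + 1)} (hx : (wprod n c x : ℕ) + 1 = k)
    (hy : (wprod n c y : ℕ) = k) : x < y := by
  have hw : w = sgen n k * wprod n c := hr.2.1.symm
  by_contra hlt
  have hne : x ≠ y := by rintro rfl; omega
  have := hr.inverts_of_suffix (a := [k]) (lt_of_le_of_ne (not_lt.1 hlt) hne.symm)
    (by rw [Fin.lt_def]; omega)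
  rw [hw, sgen_eq_swap hx hy] at this
  simp only [Equiv.Perm.mul_apply, Equiv.swap_apply_left, Equiv.swap_apply_right,
    Fin.lt_def] at this
  omega

/-- A permutation with a reduced word containing a braid factor has a decreasing triple. -/
theorem IsReducedWord.exists_decreasing_triple {n : ℕ} {w : Equiv.Perm (Fin (n + 1))}
    {l : List ℕ} (hr : IsReducedWord n w l) {i i' : ℕ} (hi : i + 1 = i' ∨ i' + 1 = i)
    (hl : [i, i', i] <:+: l) : ∃ x y z, x < y ∧ y < z ∧ w z < w y ∧ w y < w x := by
  obtain ⟨a, b, rfl⟩ := hl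
  have hvi := hr.1 i (by simp)
  have hvi' := hr.1 i' (by simp)
  have r1 : IsReducedWord n _ (i :: b) :=
    IsReducedWord.of_append (a := a ++ [i, i']) (c := []) (by simpa using hr)
  have r2 : IsReducedWord n _ (i' :: i :: b) :=
    IsReducedWord.of_append (a := a ++ [i]) (c := []) (by simpa using hr)
  have r3 : IsReducedWord n _ (i :: i' :: i :: b) :=
    IsReducedWord.of_append (a := a) (c := []) (by simpa using hr)
  have hr' : IsReducedWord n w (a ++ (i :: i' :: i :: b)) := by simpa using hr
  have hsurj : ∀ m, m ≤ n → ∃ x, (wprod n b x : ℕ) = m := fun m hm =>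
    ⟨(wprod n b).symm ⟨m, by omega⟩, by simp⟩
  obtain ⟨x, hx⟩ := hsurj (min i i' - 1) (by omega)
  obtain ⟨y, hy⟩ := hsurj (min i i') (by omega)
  obtain ⟨z, hz⟩ := hsurj (min i i' + 1) (by omega)
  have hxy : x < y := by
    rcases hi with hi | hi
    · refine r1.lt_of_cons ?_ ?_ <;> grind
    · refine r3.lt_of_cons ?_ ?_ <;>
        simp only [wprod_cons, Equiv.Perm.mul_apply, sgen_apply_val] <;> grind
  have hyz : y < z := by
    rcases hi with hi | hi
    · refine r3.lt_of_cons ?_ ?_ <;>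
        simp only [wprod_cons, Equiv.Perm.mul_apply, sgen_apply_val] <;> grind
    · refine r1.lt_of_cons ?_ ?_ <;> grind
  refine ⟨x, y, z, hxy, hyz, hr'.inverts_of_suffix hyz ?_, hr'.inverts_of_suffix hxy ?_⟩ <;>
    simp only [wprod_cons, Equiv.Perm.mul_apply, Fin.lt_def, sgen_apply_val] <;> grind

/-! ### The permutation given by a canonical expression -/

/-- The strict componentwise order on pairs that governs consecutive segments. -/
def SegLT (p q : ℕ × ℕ) : Prop := p.1 < q.1 ∧ p.2 < q.2

instance : IsTrans (ℕ × ℕ) SegLT := ⟨fun _ _ _ h h' => ⟨h.1.trans h'.1, h.2.trans h'.2⟩⟩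

instance : Std.Irrefl SegLT := ⟨fun _ h => lt_irrefl _ h.1⟩

theorem segWord_succ {i j : ℕ} (h : i ≤ j + 1) : segWord i (j + 1) = (j + 1) :: segWord i j := by
  simp only [segWord]
  rw [show j + 1 + 1 - i = (j + 1 - i) + 1 by omega, List.range'_concat, List.reverse_append]
  simp only [List.reverse_cons, List.reverse_nil, List.nil_append, List.cons_append]
  congr 1
  omega

theorem segWord_eq_nil {i j : ℕ} (h : j < i) : segWord i j = [] := by
  simp [segWord, show j + 1 - i = 0 by omega]

theorem mem_segWord {i j k : ℕ} : k ∈ segWord i j ↔ i ≤ k ∧ k ≤ j := by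
  simp [segWord, List.mem_range'_1]
  omega

theorem segWord_append {i j k : ℕ} (h1 : i ≤ k + 1) (h2 : k ≤ j) :
    segWord i j = segWord (k + 1) j ++ segWord i k := by
  induction j, h2 using Nat.le_induction with
  | base => rw [segWord_eq_nil (Nat.lt_succ_self k)]; rfl
  | succ j hj ih => rw [segWord_succ (by omega), segWord_succ (by omega), ih]; rfl

theorem segWord_self (i : ℕ) : segWord i i = [i] := by
  simp [segWord]

theorem seg_apply_val {n i j : ℕ} (hi : 1 ≤ i) (hij : i ≤ j) (hj : j ≤ n) (v : Fin (n + 1)) :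
    (seg n i j v : ℕ) =
      if (v : ℕ) + 1 = i then j else if i ≤ (v : ℕ) ∧ (v : ℕ) ≤ j then v - 1 else v := by
  change (wprod n (segWord i j) v : ℕ) = _
  induction j, hij using Nat.le_induction with
  | base =>
    rw [segWord_self, wprod_cons, wprod_nil, mul_one, sgen_apply_val]
    grind
  | succ j hij ih =>
    rw [segWord_succ (by omega), wprod_cons, Equiv.Perm.mul_apply, sgen_apply_val,
      ih (by omega)]
    grind

section Canonical

variable {n : ℕ} {ps : List (ℕ × ℕ)}

theorem segProd_apply_of_lt (hv : ∀ p ∈ ps, 1 ≤ p.1 ∧ p.1 ≤ p.2 ∧ p.2 ≤ n)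
    {x : Fin (n + 1)} (hx : ∀ p ∈ ps, (x : ℕ) + 1 < p.1) :
    (ps.map (fun p => seg n p.1 p.2)).prod x = x := by
  induction ps with
  | nil => rfl
  | cons p ps ih =>
    simp only [List.mem_cons, forall_eq_or_imp] at hv hx
    rw [List.map_cons, List.prod_cons, Equiv.Perm.mul_apply, ih hv.2 hx.2, Fin.ext_iff,
      seg_apply_val hv.1.1 hv.1.2.1 hv.1.2.2]
    grind

theorem segProd_apply_of_mem (hv : ∀ p ∈ ps, 1 ≤ p.1 ∧ p.1 ≤ p.2 ∧ p.2 ≤ n)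
    (hs : ps.Pairwise SegLT) {x : Fin (n + 1)} {p : ℕ × ℕ} (hp : p ∈ ps)
    (hx : (x : ℕ) + 1 = p.1) : ((ps.map (fun p => seg n p.1 p.2)).prod x : ℕ) = p.2 := by
  induction ps with
  | nil => simp at hp
  | cons q ps ih =>
    simp only [List.mem_cons, forall_eq_or_imp] at hv
    rw [List.pairwise_cons] at hs
    rw [List.map_cons, List.prod_cons, Equiv.Perm.mul_apply,
      seg_apply_val hv.1.1 hv.1.2.1 hv.1.2.2]
    rcases List.mem_cons.1 hp with rfl | hp
    · rw [segProd_apply_of_lt hv.2 fun r hr => hx ▸ (hs.1 r hr).1, if_pos hx]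
    · have := hs.1 p hp
      have := hv.2 p hp
      rw [ih hv.2 hs.2 hp]
      grind [SegLT]

theorem segProd_apply_ne {q : ℕ × ℕ} (hv : ∀ p ∈ ps, 1 ≤ p.1 ∧ p.1 ≤ p.2 ∧ p.2 ≤ n)
    (hq : ∀ p ∈ ps, SegLT q p) {x : Fin (n + 1)} (hx : (x : ℕ) + 1 ≠ q.1) :
    ((ps.map (fun p => seg n p.1 p.2)).prod x : ℕ) + 1 ≠ q.1 := by
  intro h
  have hfix := segProd_apply_of_lt hv fun p hp => h ▸ (hq p hp).1
  rw [Equiv.injective _ hfix] at h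
  exact hx h

theorem segProd_apply_le (hv : ∀ p ∈ ps, 1 ≤ p.1 ∧ p.1 ≤ p.2 ∧ p.2 ≤ n)
    (hs : ps.Pairwise SegLT) {x : Fin (n + 1)} (hx : ∀ p ∈ ps, (x : ℕ) + 1 ≠ p.1) :
    (ps.map (fun p => seg n p.1 p.2)).prod x ≤ x := by
  induction ps with
  | nil => exact le_rfl
  | cons q ps ih =>
    simp only [List.mem_cons, forall_eq_or_imp] at hv hx
    rw [List.pairwise_cons] at hs
    have h1 := segProd_apply_ne hv.2 hs.1 hx.1
    have h2 := ih hv.2 hs.2 hx.2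
    rw [Fin.le_def] at h2 ⊢
    rw [List.map_cons, List.prod_cons, Equiv.Perm.mul_apply,
      seg_apply_val hv.1.1 hv.1.2.1 hv.1.2.2]
    grind

theorem segProd_apply_lt (hv : ∀ p ∈ ps, 1 ≤ p.1 ∧ p.1 ≤ p.2 ∧ p.2 ≤ n)
    (hs : ps.Pairwise SegLT) {x y : Fin (n + 1)} (hx : ∀ p ∈ ps, (x : ℕ) + 1 ≠ p.1)
    (hy : ∀ p ∈ ps, (y : ℕ) + 1 ≠ p.1) (hxy : x < y) :
    (ps.map (fun p => seg n p.1 p.2)).prod x < (ps.map (fun p => seg n p.1 p.2)).prod y := by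
  induction ps with
  | nil => exact hxy
  | cons q ps ih =>
    simp only [List.mem_cons, forall_eq_or_imp] at hv hx hy
    rw [List.pairwise_cons] at hs
    have h1 := segProd_apply_ne hv.2 hs.1 hx.1
    have h2 := segProd_apply_ne hv.2 hs.1 hy.1
    have h3 := ih hv.2 hs.2 hx.2 hy.2
    rw [Fin.lt_def] at h3 ⊢
    simp only [List.map_cons, List.prod_cons, Equiv.Perm.mul_apply,
      seg_apply_val hv.1.1 hv.1.2.1 hv.1.2.2]
    grind

/-- The segments of a canonical expression are the excedances of its product. -/
theorem mem_iff_segProd_apply (hv : ∀ p ∈ ps, 1 ≤ p.1 ∧ p.1 ≤ p.2 ∧ p.2 ≤ n)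
    (hs : ps.Pairwise SegLT) (p : ℕ × ℕ) :
    p ∈ ps ↔ p.1 ≤ p.2 ∧ ∃ x : Fin (n + 1), (x : ℕ) + 1 = p.1 ∧
      ((ps.map (fun p => seg n p.1 p.2)).prod x : ℕ) = p.2 := by
  constructor
  · intro hp
    have := hv p hp
    have hx : ((⟨p.1 - 1, by omega⟩ : Fin (n + 1)) : ℕ) + 1 = p.1 := by simp only; omega
    exact ⟨this.2.1, _, hx, segProd_apply_of_mem hv hs hp hx⟩
  · rintro ⟨hle, x, hx, hwx⟩
    by_cases h : ∀ q ∈ ps, (x : ℕ) + 1 ≠ q.1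
    · have := segProd_apply_le hv hs h
      rw [Fin.le_def] at this
      omega
    · push Not at h
      obtain ⟨q, hq, hxq⟩ := h
      have := segProd_apply_of_mem hv hs hq hxq
      rwa [Prod.ext (hx.symm.trans hxq) (hwx.symm.trans this)]

theorem canonical_unique {ps' : List (ℕ × ℕ)}
    (hv : ∀ p ∈ ps, 1 ≤ p.1 ∧ p.1 ≤ p.2 ∧ p.2 ≤ n) (hs : ps.Pairwise SegLT)
    (hv' : ∀ p ∈ ps', 1 ≤ p.1 ∧ p.1 ≤ p.2 ∧ p.2 ≤ n) (hs' : ps'.Pairwise SegLT)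
    (h : (ps.map (fun p => seg n p.1 p.2)).prod = (ps'.map (fun p => seg n p.1 p.2)).prod) :
    ps = ps' :=
  hs.eq_of_mem_iff hs' fun p => by
    rw [mem_iff_segProd_apply hv hs, mem_iff_segProd_apply hv' hs', h]

theorem segProd_no_decreasing_triple (hv : ∀ p ∈ ps, 1 ≤ p.1 ∧ p.1 ≤ p.2 ∧ p.2 ≤ n)
    (hs : ps.Pairwise SegLT) {w : Equiv.Perm (Fin (n + 1))}
    (hw : w = (ps.map (fun p => seg n p.1 p.2)).prod) {x y z : Fin (n + 1)} (hxy : x < y)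
    (hyz : y < z) (h1 : w z < w y) (h2 : w y < w x) : False := by
  subst hw
  have hmem : ∀ {a b : Fin (n + 1)}, (¬ ∀ p ∈ ps, (a : ℕ) + 1 ≠ p.1) →
      (¬ ∀ p ∈ ps, (b : ℕ) + 1 ≠ p.1) → a < b →
      (ps.map (fun p => seg n p.1 p.2)).prod a < (ps.map (fun p => seg n p.1 p.2)).prod b := by
    intro a b ha hb hab
    push Not at ha hb
    obtain ⟨p, hp, hap⟩ := ha
    obtain ⟨q, hq, hbq⟩ := hb
    rw [Fin.lt_def, segProd_apply_of_mem hv hs hp hap, segProd_apply_of_mem hv hs hq hbq]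
    rw [Fin.lt_def] at hab
    have htri : SegLT p q ∨ p = q ∨ SegLT q p := by
      obtain ⟨s, hps, rfl⟩ := List.getElem_of_mem hp
      obtain ⟨t, hqt, rfl⟩ := List.getElem_of_mem hq
      rcases lt_trichotomy s t with h | rfl | h
      · exact Or.inl (List.pairwise_iff_getElem.1 hs _ _ _ _ h)
      · exact Or.inr (Or.inl rfl)
      · exact Or.inr (Or.inr (List.pairwise_iff_getElem.1 hs _ _ _ _ h))
    rcases htri with h | rfl | h
    · exact h.2
    · omega
    · have := h.1
      omega
  have hnot := @segProd_apply_lt n ps hv hs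
  by_cases hx : ∀ p ∈ ps, (x : ℕ) + 1 ≠ p.1 <;> by_cases hy : ∀ p ∈ ps, (y : ℕ) + 1 ≠ p.1 <;>
    by_cases hz : ∀ p ∈ ps, (z : ℕ) + 1 ≠ p.1
  · exact lt_asymm h2 (hnot hx hy hxy)
  · exact lt_asymm h2 (hnot hx hy hxy)
  · exact lt_asymm (h1.trans h2) (hnot hx hz (hxy.trans hyz))
  · exact lt_asymm h1 (hmem hy hz hyz)
  · exact lt_asymm h1 (hnot hy hz hyz)
  · exact lt_asymm (h1.trans h2) (hmem hx hz (hxy.trans hyz))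
  · exact lt_asymm h2 (hmem hx hy hxy)
  · exact lt_asymm h2 (hmem hx hy hxy)

end Canonical

/-! ### Bringing words into canonical form -/

/-- Two words are rearrangements of each other with the same product. -/
def WordEquiv (n : ℕ) (l l' : List ℕ) : Prop := l.Perm l' ∧ wprod n l = wprod n l'

theorem WordEquiv.rfl {n : ℕ} {l : List ℕ} : WordEquiv n l l := ⟨.refl _, Eq.refl _⟩

theorem WordEquiv.symm {n : ℕ} {l l' : List ℕ} (h : WordEquiv n l l') : WordEquiv n l' l :=
  ⟨h.1.symm, h.2.symm⟩

theorem WordEquiv.trans {n : ℕ} {l l' l'' : List ℕ} (h : WordEquiv n l l')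
    (h' : WordEquiv n l' l'') : WordEquiv n l l'' := ⟨h.1.trans h'.1, h.2.trans h'.2⟩

theorem WordEquiv.append {n : ℕ} {a a' b b' : List ℕ} (h : WordEquiv n a a')
    (h' : WordEquiv n b b') : WordEquiv n (a ++ b) (a' ++ b') :=
  ⟨h.1.append h'.1, by rw [wprod_append, wprod_append, h.2, h'.2]⟩

theorem WordEquiv.comm {n k : ℕ} {l : List ℕ} (h : ∀ i ∈ l, i + 2 ≤ k ∨ k + 2 ≤ i) :
    WordEquiv n (l ++ [k]) ([k] ++ l) := by
  refine ⟨List.perm_append_comm, ?_⟩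
  rw [wprod_append, wprod_append]
  refine Commute.list_prod_left _ _ fun g hg => ?_
  obtain ⟨i, hi, rfl⟩ := List.mem_map.1 hg
  simpa [wprod] using sgen_commute (n := n) (h i hi)

theorem WordEquiv.isReducedWord {n : ℕ} {w : Equiv.Perm (Fin (n + 1))} {l l' : List ℕ}
    (h : WordEquiv n l l') (hr : IsReducedWord n w l) : IsReducedWord n w l' :=
  hr.of_length_le (fun i hi => hr.1 i (h.1.mem_iff.2 hi)) (h.2 ▸ hr.2.1) h.1.length_eq.ge

/-- A word that visibly fails to be reduced and fully commutative: it contains a repeated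
letter or a braid factor. -/
def HasObstruction (l : List ℕ) : Prop :=
  ∃ a b c, l = a ++ b ++ c ∧ ((∃ i, b = [i, i]) ∨
    ∃ i i', (i + 1 = i' ∨ i' + 1 = i) ∧ b = [i, i', i])

theorem HasObstruction.append {l : List ℕ} (h : HasObstruction l) (m : List ℕ) :
    HasObstruction (l ++ m) := by
  obtain ⟨a, b, c, rfl, hb⟩ := h
  exact ⟨a, b, c ++ m, by simp, hb⟩

theorem FullyCommutative.not_hasObstruction {n : ℕ} {w : Equiv.Perm (Fin (n + 1))}
    (hw : FullyCommutative n w) {l : List ℕ} (hr : IsReducedWord n w l) :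
    ¬ HasObstruction l := by
  rintro ⟨a, b, c, rfl, ⟨i, rfl⟩ | ⟨i, i', hi, rfl⟩⟩
  · have := hr.of_append.2.2 [] (by simp) (by
      simp only [wprod_cons, wprod_nil, mul_one, sgen]
      split_ifs <;> simp)
    simp at this
  · exact hw _ hr i i' hi ⟨a, c, rfl⟩

/-- The word spelling the product of the segments in `rs`, the last segment listed first. -/
def revSegWord : List (ℕ × ℕ) → List ℕ
  | [] => []
  | p :: rs => revSegWord rs ++ segWord p.1 p.2

theorem wprod_revSegWord (n : ℕ) (rs : List (ℕ × ℕ)) :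
    wprod n (revSegWord rs) = (rs.reverse.map (fun p => seg n p.1 p.2)).prod := by
  induction rs with
  | nil => rfl
  | cons p rs ih =>
    rw [revSegWord, wprod_append, ih]
    simp only [List.reverse_cons, List.map_append, List.prod_append, List.map_cons, List.map_nil,
      List.prod_cons, List.prod_nil, mul_one]
    rfl

theorem snd_mem_revSegWord {rs : List (ℕ × ℕ)} {p : ℕ × ℕ} (hp : p ∈ rs) (h : p.1 ≤ p.2) :
    p.2 ∈ revSegWord rs := by
  induction rs with
  | nil => simp at hp
  | cons q rs ih =>
    rw [revSegWord, List.mem_append]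
    rcases List.mem_cons.1 hp with rfl | hp
    · exact Or.inr (mem_segWord.2 ⟨h, le_rfl⟩)
    · exact Or.inl (ih hp)

/-- Appending a letter to a canonical word gives, up to commutations, either a word with an
obstruction or a canonical word, obtained by adding a new segment or lengthening an old one. -/
theorem revSegWord_append_letter (n k : ℕ) (hk : 1 ≤ k) (rs : List (ℕ × ℕ))
    (hv : ∀ p ∈ rs, 1 ≤ p.1 ∧ p.1 ≤ p.2) (hs : rs.Pairwise (flip SegLT)) :
    (∃ l, WordEquiv n (revSegWord rs ++ [k]) l ∧ HasObstruction l) ∨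
    ∃ rs', WordEquiv n (revSegWord rs ++ [k]) (revSegWord rs') ∧ rs'.Pairwise (flip SegLT) ∧
      ∀ p ∈ rs', 1 ≤ p.1 ∧ p.1 ≤ p.2 ∧ (p = (k, k) ∨ ∃ q ∈ rs, p.1 ≤ q.1 ∧ p.2 = q.2) := by
  induction rs with
  | nil =>
    refine Or.inr ⟨[(k, k)], ?_, by simp, by simp [hk]⟩
    simpa [revSegWord, segWord_self] using WordEquiv.rfl
  | cons p rs ih =>
    obtain ⟨i, m⟩ := p
    have hv0 := hv
    have hs0 := hs
    simp only [List.mem_cons, forall_eq_or_imp] at hv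
    rw [List.pairwise_cons] at hs
    obtain ⟨⟨hi, him⟩, hv⟩ := hv
    obtain ⟨hlt, hs⟩ := hs
    have hkeep : ∀ q ∈ (i, m) :: rs, 1 ≤ q.1 ∧ q.1 ≤ q.2 ∧
        (q = (k, k) ∨ ∃ r ∈ (i, m) :: rs, q.1 ≤ r.1 ∧ q.2 = r.2) := fun q hq =>
      ⟨(hv0 q hq).1, (hv0 q hq).2, Or.inr ⟨q, hq, le_rfl, rfl⟩⟩
    rcases lt_or_ge m k with hmk | hkm
    · refine Or.inr ⟨(k, k) :: (i, m) :: rs, ?_, ?_, ?_⟩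
      · simpa [revSegWord, segWord_self] using WordEquiv.rfl
      · refine List.pairwise_cons.2 ⟨fun q hq => ?_, hs0⟩
        rcases List.mem_cons.1 hq with rfl | hq
        · exact ⟨by simp only; omega, hmk⟩
        · have := hlt q hq
          simp only [flip, SegLT] at this ⊢
          omega
      · intro q hq
        rcases List.mem_cons.1 hq with rfl | hq
        · exact ⟨hk, le_rfl, Or.inl rfl⟩
        · exact hkeep q hq
    rcases lt_trichotomy i k with hik | rfl | hki
    · left
      obtain ⟨j, rfl⟩ : ∃ j, k = j + 2 := ⟨k - 2, by omega⟩
      refine ⟨revSegWord rs ++ segWord (j + 3) m ++ [j + 2, j + 1] ++ ([j + 2] ++ segWord i j),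
        ?_, revSegWord rs ++ segWord (j + 3) m, [j + 2, j + 1, j + 2], segWord i j, by simp,
        Or.inr ⟨_, _, Or.inr rfl, rfl⟩⟩
      have hsplit : revSegWord ((i, m) :: rs) ++ [j + 2] =
          revSegWord rs ++ segWord (j + 3) m ++ [j + 2, j + 1] ++ (segWord i j ++ [j + 2]) := by
        rw [revSegWord, segWord_append (k := j + 2) (by omega) hkm, segWord_succ (by omega),
          segWord_succ (by omega)]
        simp
      rw [hsplit]
      exact WordEquiv.rfl.append (WordEquiv.comm fun r hr => by
        rw [mem_segWord] at hr; omega)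
    · refine Or.inl ⟨_, WordEquiv.rfl, revSegWord rs ++ segWord (i + 1) m, [i, i], [], ?_,
        Or.inl ⟨i, rfl⟩⟩
      rw [revSegWord, segWord_append (k := i) (by omega) him, segWord_self]
      simp
    rcases (Nat.succ_le_of_lt hki).lt_or_eq with hki | rfl
    · have hcomm : WordEquiv n (revSegWord ((i, m) :: rs) ++ [k])
          (revSegWord rs ++ [k] ++ segWord i m) := by
        rw [revSegWord, List.append_assoc, List.append_assoc]
        exact WordEquiv.rfl.append (WordEquiv.comm fun r hr => by
          rw [mem_segWord] at hr; omega)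
      rcases ih hv hs with ⟨l, hl, hobs⟩ | ⟨rs', he, hs', hv'⟩
      · exact Or.inl ⟨_, hcomm.trans (hl.append .rfl), hobs.append _⟩
      · refine Or.inr ⟨(i, m) :: rs', hcomm.trans (he.append .rfl),
          List.pairwise_cons.2 ⟨fun q hq => ?_, hs'⟩, fun q hq => ?_⟩
        · rcases (hv' q hq).2.2 with rfl | ⟨r, hr, h1, h2⟩
          · simp only [flip, SegLT]; omega
          · have := hlt r hr
            simp only [flip, SegLT] at this ⊢
            omega
        · rcases List.mem_cons.1 hq with rfl | hq
          · exact hkeep _ List.mem_cons_self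
          · obtain ⟨h1, h2, h3⟩ := hv' q hq
            exact ⟨h1, h2, h3.imp_right fun ⟨r, hr, h⟩ => ⟨r, List.mem_cons_of_mem _ hr, h⟩⟩
    · by_cases hmem : ∀ q ∈ rs, q.1 < k
      · refine Or.inr ⟨(k, m) :: rs, ?_, List.pairwise_cons.2 ⟨fun q hq => ?_, hs⟩, fun q hq => ?_⟩
        · rw [revSegWord, revSegWord, segWord_append (i := k) (k := k) (by omega) hkm,
            segWord_self, List.append_assoc]
          exact .rfl
        · exact ⟨hmem q hq, (hlt q hq).2⟩
        · rcases List.mem_cons.1 hq with rfl | hq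
          · exact ⟨hk, hkm, Or.inr ⟨_, List.mem_cons_self, by simp, rfl⟩⟩
          · exact hkeep q (List.mem_cons_of_mem _ hq)
      · left
        cases rs with
        | nil => simp at hmem
        | cons q rs =>
          obtain ⟨i', m'⟩ := q
          have hlt' := hlt _ List.mem_cons_self
          have hv1 := hv _ List.mem_cons_self
          rw [List.pairwise_cons] at hs
          have : i' = k := by
            by_contra hne
            refine hmem fun r hr => ?_
            simp only [flip, SegLT] at hlt'
            rcases List.mem_cons.1 hr with rfl | hr
            · simp only; omega
            · have := hs.1 r hr
              simp only [flip, SegLT] at this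
              omega
          subst this
          simp only [flip, SegLT] at hlt' hv1
          refine ⟨revSegWord rs ++ segWord (i' + 1) m' ++ (segWord (i' + 2) m ++ [i']) ++
            [i' + 1, i'], ?_, revSegWord rs ++ segWord (i' + 1) m' ++ segWord (i' + 2) m,
            [i', i' + 1, i'], [], by simp, Or.inr ⟨_, _, Or.inl rfl, rfl⟩⟩
          have hsplit : revSegWord ((i' + 1, m) :: (i', m') :: rs) ++ [i'] =
              revSegWord rs ++ segWord (i' + 1) m' ++ ([i'] ++ segWord (i' + 2) m) ++
                [i' + 1, i'] := by
            simp only [revSegWord]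
            rw [segWord_append (i := i') (k := i') (by omega) hv1.2, segWord_self,
              segWord_append (i := i' + 1) (k := i' + 1) (by omega) him, segWord_self]
            simp
          rw [hsplit]
          exact (WordEquiv.rfl.append (WordEquiv.comm fun r hr => by
            rw [mem_segWord] at hr; omega).symm).append .rfl

theorem FullyCommutative.of_append_letter {n k : ℕ} {l : List ℕ}
    (hr : IsReducedWord n (wprod n (l ++ [k])) (l ++ [k]))
    (hw : FullyCommutative n (wprod n (l ++ [k]))) : FullyCommutative n (wprod n l) := by
  intro l' hl' i i' hi hb
  refine hw (l' ++ [k]) ?_ i i' hi (hb.trans (List.prefix_append _ _).isInfix)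
  refine hr.of_length_le (fun j hj => ?_) ?_ ?_
  · rcases List.mem_append.1 hj with hj | hj
    · exact hl'.1 j hj
    · exact hr.1 j (List.mem_append_right _ hj)
  · rw [wprod_append, wprod_append, hl'.2.1]
  · have := hl'.2.2 l (fun j hj => hr.1 j (List.mem_append_left _ hj)) rfl
    simpa using this

theorem FullyCommutative.exists_revSegWord {n : ℕ} (l : List ℕ)
    (hr : IsReducedWord n (wprod n l) l) (hw : FullyCommutative n (wprod n l)) :
    ∃ rs, WordEquiv n l (revSegWord rs) ∧ rs.Pairwise (flip SegLT) ∧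
      ∀ p ∈ rs, 1 ≤ p.1 ∧ p.1 ≤ p.2 := by
  induction l using List.reverseRecOn with
  | nil => exact ⟨[], .rfl, .nil, by simp⟩
  | append_singleton l k ih =>
    obtain ⟨rs, he, hs, hv⟩ := ih (IsReducedWord.of_append (a := []) (c := [k]) hr)
      (.of_append_letter hr hw)
    have he' : WordEquiv n (l ++ [k]) (revSegWord rs ++ [k]) := he.append .rfl
    rcases revSegWord_append_letter n k (hr.1 k (by simp)).1 rs hv hs with
      ⟨l', hl', hobs⟩ | ⟨rs', hrs', hs', hv'⟩
    · exact absurd hobs (hw.not_hasObstruction ((he'.trans hl').isReducedWord hr))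
    · exact ⟨rs', he'.trans hrs', hs', fun p hp => ⟨(hv' p hp).1, (hv' p hp).2.1⟩⟩

/-- An element `w` of `S_{n+1}` is fully commutative if and only if it can be written
in the form `T_{i_1}^{m_1} T_{i_2}^{m_2} ⋯ T_{i_ℓ}^{m_ℓ}` with `i_j ≤ m_j` for all `j`,
`i_1 < i_2 < ⋯ < i_ℓ` and `m_1 < m_2 < ⋯ < m_ℓ`; moreover this expression is unique. -/
theorem fullyCommutative_iff_canonical (n : ℕ) (w : Equiv.Perm (Fin (n + 1))) :
    FullyCommutative n w ↔
      ∃! ps : List (ℕ × ℕ),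
        ((∀ p ∈ ps, 1 ≤ p.1 ∧ p.1 ≤ p.2 ∧ p.2 ≤ n) ∧
          List.Chain' (fun p q => p.1 < q.1 ∧ p.2 < q.2) ps) ∧
        w = (ps.map (fun p => seg n p.1 p.2)).prod := by
  have hchain : ∀ ps : List (ℕ × ℕ),
      List.IsChain (fun p q => p.1 < q.1 ∧ p.2 < q.2) ps ↔ ps.Pairwise SegLT := fun ps =>
    List.isChain_iff_pairwise (R := SegLT)
  constructor
  · intro hw
    obtain ⟨l, hr⟩ := exists_isReducedWord n w
    obtain rfl := hr.2.1
    obtain ⟨rs, he, hs, hv⟩ := hw.exists_revSegWord l hr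
    have hv' : ∀ p ∈ rs.reverse, 1 ≤ p.1 ∧ p.1 ≤ p.2 ∧ p.2 ≤ n := fun p hp => by
      rw [List.mem_reverse] at hp
      have h := hv p hp
      exact ⟨h.1, h.2, ((he.isReducedWord hr).1 _ (snd_mem_revSegWord hp h.2)).2⟩
    have hs' : rs.reverse.Pairwise SegLT := List.pairwise_reverse.2 hs
    have hprod := he.2.trans (wprod_revSegWord n rs)
    exact ⟨rs.reverse, ⟨⟨hv', (hchain _).2 hs'⟩, hprod⟩, fun ps ⟨⟨hvp, hsp⟩, hp⟩ =>
      canonical_unique hvp ((hchain _).1 hsp) hv' hs' (hp.symm.trans hprod)⟩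
  · rintro ⟨ps, ⟨⟨hv, hs⟩, hw⟩, -⟩ l hr i i' hi hb
    obtain ⟨x, y, z, hxy, hyz, h1, h2⟩ := hr.exists_decreasing_triple hi hb
    exact segProd_no_decreasing_triple hv ((hchain _).1 hs) hw hxy hyz h1 h2
end

section
/- The number of fully commutative elements in the symmetric group S_{n+1} (Coxeter group of type A_n) is the Catalan number C_{n+1} = (1/(n+2)) * binomial(2n+2, n+1). -/
open Equiv Finset

namespace FullyCommutativeCount

/-! ### Inversions and reduced words -/

theorem sgen_succ {n i : ℕ} (hi : i < n) :
    sgen n (i + 1) = swap ⟨i, by omega⟩ ⟨i + 1, by omega⟩ := by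
  simp [sgen, Nat.succ_le_of_lt hi]

theorem sgen_mul_self (n i : ℕ) : sgen n i * sgen n i = 1 := by
  unfold sgen
  split_ifs <;> simp

/-- An adjacent transposition preserves the order of every pair it does not swap. -/
theorem swap_lt_swap_iff {m i : ℕ} (hi : i + 1 < m) {a b : Fin m}
    (h₁ : ¬ (a.val = i ∧ b.val = i + 1)) (h₂ : ¬ (a.val = i + 1 ∧ b.val = i)) :
    swap (⟨i, by omega⟩ : Fin m) ⟨i + 1, hi⟩ a < swap (⟨i, by omega⟩ : Fin m) ⟨i + 1, hi⟩ b ↔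
      a < b := by
  simp only [swap_apply_def, Fin.ext_iff, Fin.lt_def]
  split_ifs <;> simp_all <;> omega

/-- The set of inversions of `w`. -/
def inversions {m : ℕ} (w : Perm (Fin m)) : Finset (Fin m × Fin m) :=
  {p | p.1 < p.2 ∧ w p.2 < w p.1}

@[simp]
theorem mem_inversions {m : ℕ} {w : Perm (Fin m)} {p : Fin m × Fin m} :
    p ∈ inversions w ↔ p.1 < p.2 ∧ w p.2 < w p.1 := by
  simp [inversions]

theorem card_inversions_mul_of_lt {n i : ℕ} (hi : i < n) (w : Perm (Fin (n + 1)))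
    (h : w ⟨i, by omega⟩ < w ⟨i + 1, by omega⟩) :
    #(inversions (w * sgen n (i + 1))) = #(inversions w) + 1 := by
  rw [sgen_succ hi]
  set x : Fin (n + 1) := ⟨i, by omega⟩ with hx
  set y : Fin (n + 1) := ⟨i + 1, by omega⟩ with hy
  have hxy : x < y := by simp [hx, hy]
  have key : inversions (w * swap x y) =
      insert (x, y) ((inversions w).map ((swap x y).prodCongr (swap x y)).toEmbedding) := by
    ext ⟨a, b⟩
    simp only [mem_insert, mem_map_equiv, mem_inversions,
      prodCongr_symm, prodCongr_apply, Prod.map_apply, symm_swap, Prod.mk.injEq,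
      Perm.coe_mul, Function.comp_apply]
    by_cases h₁ : a = x ∧ b = y
    · obtain ⟨rfl, rfl⟩ := h₁
      simp [h, hxy]
    by_cases h₂ : a = y ∧ b = x
    · obtain ⟨rfl, rfl⟩ := h₂
      simp [h.le, hxy.ne]
    rw [swap_lt_swap_iff (by omega) (by simpa [Fin.ext_iff, hx, hy] using h₁)
      (by simpa [Fin.ext_iff, hx, hy] using h₂)]
    simp [h₁]
  rw [key, card_insert_of_notMem, card_map]
  simp only [mem_map_equiv, mem_inversions,
      prodCongr_symm, prodCongr_apply, Prod.map_apply, symm_swap, swap_apply_left,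
      swap_apply_right]
  exact fun hh => hxy.asymm hh.1

theorem card_inversions_of_gt {n i : ℕ} (hi : i < n) (w : Perm (Fin (n + 1)))
    (h : w ⟨i + 1, by omega⟩ < w ⟨i, by omega⟩) :
    #(inversions w) = #(inversions (w * sgen n (i + 1))) + 1 := by
  rw [← card_inversions_mul_of_lt hi, mul_assoc, sgen_mul_self, mul_one]
  simpa [sgen_succ hi] using h

theorem card_inversions_mul_le (n i : ℕ) (w : Perm (Fin (n + 1))) :
    #(inversions (w * sgen n i)) ≤ #(inversions w) + 1 := by
  by_cases hi : 0 < i ∧ i ≤ n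
  · obtain ⟨j, rfl⟩ : ∃ j, i = j + 1 := ⟨i - 1, by omega⟩
    have hj : j < n := hi.2
    rcases lt_or_gt_of_ne (a := w ⟨j, by omega⟩) (b := w ⟨j + 1, by omega⟩) (by simp) with h | h
    · exact (card_inversions_mul_of_lt hj w h).le
    · have := card_inversions_of_gt hj w h
      omega
  · simp [sgen, hi]

theorem wprod_append (n : ℕ) (l l' : List ℕ) : wprod n (l ++ l') = wprod n l * wprod n l' := by
  simp [wprod]

theorem card_inversions_mul_wprod_le (n : ℕ) (l : List ℕ) (w : Perm (Fin (n + 1))) :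
    #(inversions (w * wprod n l)) ≤ #(inversions w) + l.length := by
  induction l generalizing w with
  | nil => simp [wprod]
  | cons i l ih =>
    have h₁ := ih (w * sgen n i)
    have h₂ := card_inversions_mul_le n i w
    simp only [wprod, List.map_cons, List.prod_cons, List.length_cons] at h₁ ⊢
    rw [← mul_assoc]
    omega

theorem inversions_one (m : ℕ) : inversions (1 : Perm (Fin m)) = ∅ := by
  ext ⟨a, b⟩
  simp only [mem_inversions, Perm.coe_one, id_eq, notMem_empty,
    iff_false]
  exact fun h => h.1.asymm h.2

theorem card_inversions_wprod_le (n : ℕ) (l : List ℕ) : #(inversions (wprod n l)) ≤ l.length := by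
  simpa [inversions_one] using card_inversions_mul_wprod_le n l 1

/-- Every permutation is spelled by a word whose length is its number of inversions. -/
theorem exists_word (n : ℕ) (w : Perm (Fin (n + 1))) :
    ∃ l : List ℕ, (∀ i ∈ l, 1 ≤ i ∧ i ≤ n) ∧ wprod n l = w ∧ l.length = #(inversions w) := by
  induction hN : #(inversions w) generalizing w with
  | zero =>
    refine ⟨[], by simp, ?_, rfl⟩
    have hmono : StrictMono w := fun a b hab => by
      by_contra h
      have : (a, b) ∈ inversions w := by
        simp only [mem_inversions]
        exact ⟨hab, lt_of_le_of_ne (not_lt.mp h) (by simpa using hab.ne')⟩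
      simp [card_eq_zero.mp hN] at this
    refine Equiv.ext fun a => ?_
    have := congrArg (fun f : Fin (n + 1) ≃o Fin (n + 1) => f a)
      (Subsingleton.elim (hmono.orderIsoOfSurjective w w.surjective) (OrderIso.refl _))
    simpa [wprod, eq_comm] using this
  | succ N ih =>
    obtain ⟨i, hi, h⟩ : ∃ (i : ℕ) (hi : i < n),
        w ⟨i + 1, by omega⟩ < w ⟨i, by omega⟩ := by
      by_contra! hcon
      have hmono : Monotone w := Fin.monotone_iff_le_succ.mpr fun i => hcon i i.2
      have : inversions w = ∅ := by
        ext ⟨a, b⟩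
        simp only [mem_inversions, notMem_empty, iff_false]
        exact fun h => (hmono h.1.le).not_gt h.2
      simp [this] at hN
    have hcard := card_inversions_of_gt hi w h
    obtain ⟨l, hl, hw, hlen⟩ := ih (w * sgen n (i + 1)) (by omega)
    refine ⟨l ++ [i + 1], ?_, ?_, by simp [hlen]⟩
    · simp only [List.mem_append, List.mem_singleton]
      rintro j (hj | rfl)
      · exact hl j hj
      · omega
    · rw [wprod_append, hw]
      simp [wprod, mul_assoc, sgen_mul_self]

theorem isReducedWord_iff {n : ℕ} {w : Perm (Fin (n + 1))} {l : List ℕ} :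
    IsReducedWord n w l ↔
      (∀ i ∈ l, 1 ≤ i ∧ i ≤ n) ∧ wprod n l = w ∧ l.length = #(inversions w) := by
  refine and_congr_right fun _ => and_congr_right fun hw => ⟨fun h => ?_, fun h l' _ hl' => ?_⟩
  · obtain ⟨l', hl', hw', hlen⟩ := exists_word n w
    exact le_antisymm (hlen ▸ h l' hl' hw') (hw ▸ card_inversions_wprod_le n l)
  · rw [h, ← hl']
    exact card_inversions_wprod_le n l'

/-! ### Fully commutative permutations are the `321`-avoiding ones -/

/-- `w` has no decreasing subsequence of length three. -/
def Avoids321 {m : ℕ} (w : Perm (Fin m)) : Prop :=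
  ∀ a b c, a < b → b < c → w b < w a → ¬ w c < w b

theorem IsReducedWord.append_left {n : ℕ} {w : Perm (Fin (n + 1))} {l l' : List ℕ}
    (h : IsReducedWord n w (l ++ l')) : IsReducedWord n (wprod n l) l := by
  rw [isReducedWord_iff] at h ⊢
  obtain ⟨hl, rfl, hlen⟩ := h
  refine ⟨fun i hi => hl i (List.mem_append_left _ hi), rfl, ?_⟩
  have h₁ := card_inversions_mul_wprod_le n l' (wprod n l)
  have h₂ := card_inversions_wprod_le n l
  rw [wprod_append, List.length_append] at hlen
  omega

/-- The last letter of a reduced word is an ascent of the product of the preceding ones. -/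
theorem IsReducedWord.lt_of_append_singleton {n i : ℕ} {w : Perm (Fin (n + 1))} {l : List ℕ}
    (h : IsReducedWord n w (l ++ [i + 1])) (hi : i < n) :
    wprod n l ⟨i, by omega⟩ < wprod n l ⟨i + 1, by omega⟩ := by
  by_contra hlt
  have hgt := lt_of_le_of_ne (not_lt.mp hlt) (by simp)
  have h₁ := card_inversions_of_gt hi _ hgt
  have h₂ := card_inversions_wprod_le n l
  obtain ⟨-, rfl, hlen⟩ := isReducedWord_iff.mp h
  simp only [wprod_append, List.length_append, List.length_singleton] at hlen
  simp only [wprod, List.map_singleton, List.prod_singleton] at hlen h₁ h₂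
  omega

theorem Avoids321.of_mul_sgen {n i : ℕ} (hi : i < n) {w : Perm (Fin (n + 1))}
    (hlt : w ⟨i, by omega⟩ < w ⟨i + 1, by omega⟩)
    (h : Avoids321 (w * sgen n (i + 1))) : Avoids321 w := by
  have hmono : ∀ a b, a < b → w b < w a → sgen n (i + 1) a < sgen n (i + 1) b := by
    intro a b hab hw
    rw [sgen_succ hi, swap_lt_swap_iff (by omega)]
    · exact hab
    · rintro ⟨ha, hb⟩
      have ha' : a = ⟨i, by omega⟩ := Fin.ext ha
      have hb' : b = ⟨i + 1, by omega⟩ := Fin.ext hb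
      exact hlt.asymm (ha' ▸ hb' ▸ hw)
    · rw [Fin.lt_def] at hab
      omega
  have hself : ∀ a, sgen n (i + 1) (sgen n (i + 1) a) = a := fun a => by
    rw [← Perm.mul_apply, sgen_mul_self, Perm.one_apply]
  intro a b c hab hbc hba hcb
  refine h _ _ _ (hmono a b hab hba) (hmono b c hbc hcb) ?_ ?_ <;>
    simpa [hself]

theorem Avoids321.of_isReducedWord_append {n : ℕ} {w : Perm (Fin (n + 1))} {l l' : List ℕ}
    (hr : IsReducedWord n w (l ++ l')) (h : Avoids321 w) : Avoids321 (wprod n l) := by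
  induction l' using List.reverseRecOn generalizing w with
  | nil =>
    obtain ⟨-, rfl, -⟩ := hr
    simpa using h
  | append_singleton l' j ih =>
    rw [← List.append_assoc] at hr
    obtain ⟨hj, hj'⟩ := hr.1 j (by simp)
    obtain ⟨i, rfl⟩ : ∃ i, j = i + 1 := ⟨j - 1, by omega⟩
    refine ih (IsReducedWord.append_left hr) ?_
    refine Avoids321.of_mul_sgen hj' (IsReducedWord.lt_of_append_singleton hr hj') ?_
    obtain ⟨-, rfl, -⟩ := hr
    simpa [wprod_append, wprod, mul_assoc] using h

theorem sgen_apply_left {n i : ℕ} (hi : i < n) (h : i < n + 1) :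
    sgen n (i + 1) ⟨i, h⟩ = ⟨i + 1, by omega⟩ := by
  simp [sgen_succ hi]

theorem sgen_apply_right {n i : ℕ} (hi : i < n) (h : i + 1 < n + 1) :
    sgen n (i + 1) ⟨i + 1, h⟩ = ⟨i, by omega⟩ := by
  simp [sgen_succ hi]

theorem sgen_apply_of_ne {n i j : ℕ} (h : j < n + 1) (h₁ : j ≠ i) (h₂ : j ≠ i + 1) :
    sgen n (i + 1) ⟨j, h⟩ = ⟨j, h⟩ := by
  by_cases hi : i < n
  · rw [sgen_succ hi, swap_apply_of_ne_of_ne] <;> simpa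
  · simp [sgen, hi]

theorem Avoids321.fullyCommutative {n : ℕ} {w : Perm (Fin (n + 1))} (h : Avoids321 w) :
    FullyCommutative n w := by
  rintro l hl i i' hii' ⟨l₁, l₂, rfl⟩
  have h' := Avoids321.of_isReducedWord_append hl h
  have hr₃ := IsReducedWord.append_left hl
  have hr₃' : IsReducedWord n (wprod n (l₁ ++ [i, i', i])) ((l₁ ++ [i] ++ [i']) ++ [i]) := by
    simpa using hr₃
  have hr₂ := IsReducedWord.append_left hr₃'
  have hr₁ := IsReducedWord.append_left hr₂
  obtain ⟨hi, hi'⟩ : (1 ≤ i ∧ i ≤ n) ∧ (1 ≤ i' ∧ i' ≤ n) :=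
    ⟨hl.1 i (by simp), hl.1 i' (by simp)⟩
  obtain ⟨j, rfl⟩ : ∃ j, i = j + 1 := ⟨i - 1, by omega⟩
  obtain ⟨j', rfl⟩ : ∃ j', i' = j' + 1 := ⟨i' - 1, by omega⟩
  have h₁ := IsReducedWord.lt_of_append_singleton hr₁ hi.2
  have h₂ := IsReducedWord.lt_of_append_singleton hr₂ hi'.2
  have h₃ := IsReducedWord.lt_of_append_singleton hr₃' hi.2
  have hw : wprod n (l₁ ++ [j + 1, j' + 1, j + 1]) =
      wprod n l₁ * (sgen n (j + 1) * (sgen n (j' + 1) * sgen n (j + 1))) := by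
    simp [wprod]
  rw [hw] at h'
  simp only [wprod_append, Perm.mul_apply] at h₂ h₃
  simp only [wprod, List.map_singleton, List.prod_singleton] at h₁ h₂ h₃ h'
  rcases hii' with hj | hj
  · obtain rfl : j' = j + 1 := by omega
    have := h' ⟨j, by omega⟩ ⟨j + 1, by omega⟩ ⟨j + 1 + 1, by omega⟩ (by simp) (by simp)
    simp (disch := omega) only [Perm.mul_apply, sgen_apply_left, sgen_apply_right,
      sgen_apply_of_ne] at h₁ h₂ h₃ this
    exact this h₃ h₁
  · obtain rfl : j = j' + 1 := by omega
    have := h' ⟨j', by omega⟩ ⟨j' + 1, by omega⟩ ⟨j' + 1 + 1, by omega⟩ (by simp) (by simp)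
    simp (disch := omega) only [Perm.mul_apply, sgen_apply_left, sgen_apply_right,
      sgen_apply_of_ne] at h₁ h₂ h₃ this
    exact this h₁ h₃

/-- Appending a descent of `w` to a reduced word of `w * s_{i+1}` gives a reduced word of `w`. -/
theorem IsReducedWord.append_singleton {n i : ℕ} (hi : i < n) {w : Perm (Fin (n + 1))}
    {l : List ℕ} (h : w ⟨i + 1, by omega⟩ < w ⟨i, by omega⟩)
    (hl : IsReducedWord n (w * sgen n (i + 1)) l) : IsReducedWord n w (l ++ [i + 1]) := by
  rw [isReducedWord_iff] at hl ⊢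
  obtain ⟨hl, hw, hlen⟩ := hl
  refine ⟨?_, ?_, ?_⟩
  · simp only [List.mem_append, List.mem_singleton]
    rintro j (hj | rfl)
    · exact hl j hj
    · omega
  · rw [wprod_append, hw]
    simp [wprod, mul_assoc, sgen_mul_self]
  · simp [hlen, card_inversions_of_gt hi w h]

theorem exists_braid_of_pattern {n : ℕ} (d : ℕ) : ∀ (w : Perm (Fin (n + 1))) {a b c : ℕ}
    (hab : a < b) (hbc : b < c) (hc : c < n + 1), c - a = d →
    w ⟨b, by omega⟩ < w ⟨a, by omega⟩ → w ⟨c, hc⟩ < w ⟨b, by omega⟩ →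
    ∃ l i, IsReducedWord n w l ∧ [i, i + 1, i] <:+: l := by
  induction d using Nat.strong_induction_on with
  | _ d ih =>
  intro w a b c hab hbc hc hd hba hcb
  rcases Nat.lt_or_ge (a + 1) b with hab' | hab'
  · rcases lt_or_gt_of_ne (a := w ⟨a + 1, by omega⟩) (b := w ⟨b, by omega⟩)
      (by simp; omega) with h | h
    · obtain ⟨l, i, hl, hli⟩ := ih (c - (a + 1)) (by omega) (w * sgen n (a + 1)) hab' hbc hc rfl
        (by simpa (disch := omega) only [Perm.mul_apply, sgen_apply_right, sgen_apply_of_ne])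
        (by simpa (disch := omega) only [Perm.mul_apply, sgen_apply_of_ne])
      exact ⟨l ++ [a + 1], i, IsReducedWord.append_singleton (by omega) (h.trans hba) hl,
        hli.trans (List.prefix_append _ _).isInfix⟩
    · exact ih (c - (a + 1)) (by omega) w hab' hbc hc rfl h hcb
  obtain ⟨c, rfl⟩ : ∃ c', c = c' + 1 := ⟨c - 1, by omega⟩
  rcases Nat.lt_or_ge b c with hbc' | hbc'
  · rcases lt_or_gt_of_ne (a := w ⟨b, by omega⟩) (b := w ⟨c, by omega⟩)
      (by simp; omega) with h | h
    · obtain ⟨l, i, hl, hli⟩ := ih (c - a) (by omega) (w * sgen n (c + 1)) hab hbc' (by omega) rfl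
        (by simpa (disch := omega) only [Perm.mul_apply, sgen_apply_of_ne])
        (by simpa (disch := omega) only [Perm.mul_apply, sgen_apply_left, sgen_apply_of_ne])
      exact ⟨l ++ [c + 1], i, IsReducedWord.append_singleton (by omega) (hcb.trans h) hl,
        hli.trans (List.prefix_append _ _).isInfix⟩
    · exact ih (c - a) (by omega) w hab hbc' (by omega) rfl hba h
  obtain rfl : b = a + 1 := by omega
  obtain rfl : c = a + 1 := by omega
  obtain ⟨l, hl⟩ := exists_word n (w * sgen n (a + 1) * sgen n (a + 1 + 1) * sgen n (a + 1))
  refine ⟨l ++ [a + 1] ++ [a + 1 + 1] ++ [a + 1], a + 1, ?_, l, [], by simp⟩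
  refine IsReducedWord.append_singleton (by omega) hba
    (IsReducedWord.append_singleton (by omega) ?_
    (IsReducedWord.append_singleton (by omega) ?_ (isReducedWord_iff.mpr hl)))
  · simpa (disch := omega) only [Perm.mul_apply, sgen_apply_right, sgen_apply_of_ne]
      using hcb.trans hba
  · simpa (disch := omega) only [Perm.mul_apply, sgen_apply_left, sgen_apply_right,
      sgen_apply_of_ne] using hcb

theorem fullyCommutative_iff_avoids321 {n : ℕ} {w : Perm (Fin (n + 1))} :
    FullyCommutative n w ↔ Avoids321 w := by
  refine ⟨fun h a b c hab hbc hba hcb => ?_, Avoids321.fullyCommutative⟩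
  obtain ⟨l, i, hl, hli⟩ := exists_braid_of_pattern _ w hab hbc c.2 rfl hba hcb
  exact h l hl i (i + 1) (.inl rfl) hli

/-! ### Counting `321`-avoiding permutations -/

/-- Every inversion of `w` has its larger value at least `k`, that is, the values below `k`
occur in increasing order. -/
def IncreasingBelow {m : ℕ} (k : ℕ) (w : Perm (Fin m)) : Prop :=
  ∀ a b, a < b → w b < w a → k ≤ (w a : ℕ)

/-- The permutation starting with `p` and followed by a pattern isomorphic to `w`. -/
def consPerm {m : ℕ} (p : Fin (m + 1)) (w : Perm (Fin m)) : Perm (Fin (m + 1)) :=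
  (finSuccEquiv m).trans ((optionCongr w).trans (finSuccEquiv' p).symm)

@[simp]
theorem consPerm_zero {m : ℕ} (p : Fin (m + 1)) (w : Perm (Fin m)) : consPerm p w 0 = p := by
  simp [consPerm]

@[simp]
theorem consPerm_succ {m : ℕ} (p : Fin (m + 1)) (w : Perm (Fin m)) (i : Fin m) :
    consPerm p w i.succ = p.succAbove (w i) := by
  simp [consPerm]

theorem consPerm_bijective (m : ℕ) :
    Function.Bijective fun x : Fin (m + 1) × Perm (Fin m) => consPerm x.1 x.2 := by
  rw [Fintype.bijective_iff_injective_and_card]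
  refine ⟨?_, by simp [Fintype.card_perm, Nat.factorial_succ]⟩
  rintro ⟨p, w⟩ ⟨q, v⟩ h
  have hpq : p = q := by simpa using congrArg (fun σ => σ 0) h
  subst hpq
  refine Prod.ext rfl (Equiv.ext fun i => ?_)
  simpa using congrArg (fun σ => σ i.succ) h

theorem IncreasingBelow.mono {m k k' : ℕ} {w : Perm (Fin m)} (hk : k ≤ k')
    (h : IncreasingBelow k' w) : IncreasingBelow k w :=
  fun a b hab hba => hk.trans (h a b hab hba)

theorem increasingBelow_zero {m : ℕ} (w : Perm (Fin m)) : IncreasingBelow 0 w :=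
  fun _ _ _ _ => Nat.zero_le _

theorem avoids321_consPerm {m : ℕ} {p : Fin (m + 1)} {w : Perm (Fin m)} :
    Avoids321 (consPerm p w) ↔ Avoids321 w ∧ IncreasingBelow p w := by
  constructor
  · refine fun h => ⟨fun a b c hab hbc hba hcb => ?_, fun a b hab hba => ?_⟩
    · exact h a.succ b.succ c.succ (by simpa) (by simpa) (by simpa) (by simpa)
    · by_contra! hp
      refine h 0 a.succ b.succ (by simp) (by simpa) ?_ (by simpa)
      rw [consPerm_succ, consPerm_zero, Fin.succAbove_lt_iff_castSucc_lt]
      exact hp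
  · rintro ⟨h, hp⟩ a b c hab hbc
    obtain ⟨b, rfl⟩ := Fin.exists_succ_eq.mpr (Fin.ne_zero_of_lt hab)
    obtain ⟨c, rfl⟩ := Fin.exists_succ_eq.mpr (Fin.ne_zero_of_lt hbc)
    cases a using Fin.cases with
    | zero =>
      simp only [consPerm_succ, consPerm_zero, Fin.succAbove_lt_iff_castSucc_lt,
        Fin.succAbove_lt_succAbove_iff]
      exact fun hb hcb => absurd (hp b c (by simpa using hbc) hcb) (not_le.mpr hb)
    | succ a =>
      simpa using h a b c (by simpa using hab) (by simpa using hbc)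

theorem increasingBelow_consPerm {m k : ℕ} {p : Fin (m + 1)} {w : Perm (Fin m)}
    (hp : IncreasingBelow p w) :
    IncreasingBelow k (consPerm p w) ↔ (p = 0 ∨ k ≤ (p : ℕ)) ∧ IncreasingBelow (k - 1) w := by
  have hval : ∀ a b, a < b → w b < w a → (p.succAbove (w a) : ℕ) = w a + 1 := by
    intro a b hab hba
    rw [Fin.succAbove_of_le_castSucc _ _ (hp a b hab hba), Fin.val_succ]
  constructor
  · refine fun h => ⟨?_, fun a b hab hba => ?_⟩
    · refine or_iff_not_imp_left.mpr fun hp0 => ?_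
      obtain ⟨b, hb⟩ := (consPerm p w).surjective 0
      have hb0 : b ≠ 0 := by
        rintro rfl
        exact hp0 (by simpa using hb)
      simpa using h 0 b (Fin.pos_of_ne_zero hb0) (by simpa [hb] using Fin.pos_of_ne_zero hp0)
    · have := h a.succ b.succ (by simpa) (by simpa)
      rw [consPerm_succ, hval a b hab hba] at this
      omega
  · rintro ⟨h₀, h⟩ a b hab hba
    obtain ⟨b, rfl⟩ := Fin.exists_succ_eq.mpr (Fin.ne_zero_of_lt hab)
    cases a using Fin.cases with
    | zero =>
      rw [consPerm_zero] at hba ⊢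
      exact h₀.resolve_left (Fin.ne_zero_of_lt hba)
    | succ a =>
      have hab' : a < b := by simpa using hab
      have hba' : w b < w a := by simpa using hba
      rw [consPerm_succ, hval a b hab' hba']
      have := h a b hab' hba'
      omega

/-- The number of `321`-avoiding permutations of `Fin m` whose values below `k` occur in
increasing order. -/
noncomputable def ballotCount (m k : ℕ) : ℕ :=
  Nat.card {w : Perm (Fin m) // Avoids321 w ∧ IncreasingBelow k w}

theorem ballotCount_zero_left (k : ℕ) : ballotCount 0 k = 1 := by
  have : Unique {w : Perm (Fin 0) // Avoids321 w ∧ IncreasingBelow k w} :=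
    { default := ⟨1, fun a => a.elim0, fun a => a.elim0⟩
      uniq := fun _ => Subsingleton.elim _ _ }
  exact Nat.card_unique

theorem ballotCount_succ_left (m k : ℕ) :
    ballotCount (m + 1) k =
      ∑ p : Fin (m + 1), if p = 0 ∨ k ≤ (p : ℕ) then ballotCount m (max p (k - 1)) else 0 := by
  classical
  have e : {x : Fin (m + 1) × Perm (Fin m) //
        Avoids321 (consPerm x.1 x.2) ∧ IncreasingBelow k (consPerm x.1 x.2)} ≃
      {w : Perm (Fin (m + 1)) // Avoids321 w ∧ IncreasingBelow k w} :=
    (Equiv.ofBijective _ (consPerm_bijective m)).subtypeEquiv fun _ => Iff.rfl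
  have e' : {x : Fin (m + 1) × Perm (Fin m) //
        Avoids321 (consPerm x.1 x.2) ∧ IncreasingBelow k (consPerm x.1 x.2)} ≃
      Σ p : Fin (m + 1), {w : Perm (Fin m) //
        Avoids321 (consPerm p w) ∧ IncreasingBelow k (consPerm p w)} :=
    Equiv.subtypeProdEquivSigmaSubtype fun p w =>
      Avoids321 (consPerm p w) ∧ IncreasingBelow k (consPerm p w)
  rw [ballotCount, ← Nat.card_congr e, Nat.card_congr e', Nat.card_sigma]
  refine Finset.sum_congr rfl fun p _ => ?_
  have hiff : ∀ w : Perm (Fin m),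
      (Avoids321 (consPerm p w) ∧ IncreasingBelow k (consPerm p w)) ↔
        (p = 0 ∨ k ≤ (p : ℕ)) ∧ Avoids321 w ∧ IncreasingBelow (max p (k - 1)) w := by
    intro w
    rw [avoids321_consPerm]
    constructor
    · rintro ⟨⟨h, hp⟩, hk⟩
      obtain ⟨h₀, h₁⟩ := (increasingBelow_consPerm hp).mp hk
      exact ⟨h₀, h, fun a b hab hba => max_le (hp a b hab hba) (h₁ a b hab hba)⟩
    · rintro ⟨h₀, h, hm⟩
      have hp := hm.mono (le_max_left _ _)
      exact ⟨⟨h, hp⟩, (increasingBelow_consPerm hp).mpr ⟨h₀, hm.mono (le_max_right _ _)⟩⟩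
  split_ifs with h₀
  · exact Nat.card_congr (Equiv.subtypeEquivRight fun w => by simp [hiff, h₀])
  · have : IsEmpty {w : Perm (Fin m) //
        Avoids321 (consPerm p w) ∧ IncreasingBelow k (consPerm p w)} :=
      ⟨fun w => h₀ ((hiff w).mp w.2).1⟩
    exact Nat.card_of_isEmpty

theorem ballotCount_succ_zero (m : ℕ) :
    ballotCount (m + 1) 0 = ∑ p ∈ range (m + 1), ballotCount m p := by
  simp [ballotCount_succ_left, Finset.sum_range]

theorem ballotCount_succ_succ {m k : ℕ} (hk : k ≤ m) :
    ballotCount (m + 1) (k + 1) = ∑ p ∈ Ico k (m + 1), ballotCount m p := by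
  rw [ballotCount_succ_left, Fin.sum_univ_succ, Finset.sum_eq_sum_Ico_succ_bot (by omega)]
  have htail := Fin.sum_univ_eq_sum_range
    (fun x => if k ≤ x then ballotCount m (max (x + 1) k) else 0) m
  have hfilter : {x ∈ range m | k ≤ x} = Ico k m := by
    ext x
    simp [and_comm]
  simp only [true_or, if_true, Fin.val_zero, Nat.zero_max, Fin.succ_ne_zero, false_or,
    Fin.val_succ, Nat.add_le_add_iff_right, Nat.add_sub_cancel]
  rw [htail, ← Finset.sum_filter, hfilter, ← Finset.sum_Ico_add' _ k m 1]
  congr 1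
  refine Finset.sum_congr rfl fun x hx => ?_
  rw [max_eq_left ((mem_Ico.mp hx).1.trans (Nat.le_succ x))]

theorem sum_Ico_choose_sub {m r k : ℕ} (hr : m ≤ r) (hk : k ≤ m) :
    ∑ p ∈ Ico k (m + 1), (2 * m - p).choose r = (2 * m + 1 - k).choose (r + 1) := by
  induction hk using Nat.decreasingInduction with
  | self =>
    rw [Nat.Ico_succ_singleton, Finset.sum_singleton, show 2 * m - m = m by omega,
      show 2 * m + 1 - m = m + 1 by omega, Nat.choose_succ_succ,
      Nat.choose_eq_zero_of_lt (by omega : m < r + 1), add_zero]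
  | of_succ k hk ih =>
    rw [Finset.sum_eq_sum_Ico_succ_bot (by omega), ih,
      show 2 * m + 1 - (k + 1) = 2 * m - k by omega,
      show 2 * m + 1 - k = (2 * m - k) + 1 by omega, Nat.choose_succ_succ]

theorem ballotCount_add_choose {m k : ℕ} (hk : k ≤ m) :
    ballotCount m k + (2 * m - k).choose (m + 1) = (2 * m - k).choose m := by
  induction m generalizing k with
  | zero => simp [ballotCount_zero_left, Nat.le_zero.mp hk]
  | succ m ih =>
    have hsum : ∀ j ≤ m, ∑ p ∈ Ico j (m + 1), ballotCount m p +
        (2 * m + 1 - j).choose (m + 1 + 1) = (2 * m + 1 - j).choose (m + 1) := by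
      intro j hj
      rw [← sum_Ico_choose_sub (Nat.le_succ m) hj, ← sum_Ico_choose_sub le_rfl hj,
        ← Finset.sum_add_distrib]
      exact Finset.sum_congr rfl fun p hp => ih (Nat.lt_succ_iff.mp (mem_Ico.mp hp).2)
    cases k with
    | zero =>
      have h₀ := hsum 0 (Nat.zero_le m)
      have hsymm : (2 * m + 1).choose m = (2 * m + 1).choose (m + 1) :=
        Nat.choose_symm_of_eq_add (by omega)
      rw [Nat.sub_zero] at h₀ ⊢
      rw [ballotCount_succ_zero, Finset.range_eq_Ico, show 2 * (m + 1) = 2 * m + 1 + 1 by ring,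
        Nat.choose_succ_succ (2 * m + 1) m, Nat.choose_succ_succ (2 * m + 1) (m + 1)]
      simp only [Nat.succ_eq_add_one]
      omega
    | succ k =>
      have hk' : k ≤ m := by omega
      rw [ballotCount_succ_succ hk', show 2 * (m + 1) - (k + 1) = 2 * m + 1 - k by omega]
      exact hsum k hk'

theorem succ_mul_ballotCount_zero (m : ℕ) :
    (m + 1) * ballotCount m 0 = (2 * m).choose m := by
  have h₁ := ballotCount_add_choose (Nat.zero_le m)
  have h₂ := Nat.choose_succ_right_eq (2 * m) m
  rw [Nat.sub_zero] at h₁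
  rw [show 2 * m - m = m by omega] at h₂
  nlinarith

end FullyCommutativeCount

open FullyCommutativeCount in
/-- The number of fully commutative elements in `S_{n+1}` is the Catalan number
`C_{n+1} = (1/(n+2)) * binomial(2n+2, n+1)`. -/
theorem card_fullyCommutative (n : ℕ) :
    Nat.card {w : Equiv.Perm (Fin (n + 1)) // FullyCommutative n w} =
      Nat.choose (2 * n + 2) (n + 1) / (n + 2) := by
  have hcard : Nat.card {w : Equiv.Perm (Fin (n + 1)) // FullyCommutative n w} =
      ballotCount (n + 1) 0 :=
    Nat.card_congr (Equiv.subtypeEquivRight fun w => by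
      simp [fullyCommutative_iff_avoids321, increasingBelow_zero])
  rw [hcard, show 2 * n + 2 = 2 * (n + 1) by ring, ← succ_mul_ballotCount_zero]
  exact (Nat.mul_div_cancel_left _ (by omega)).symm
end
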